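/- With the construction below: if Z ∈ 𝒵 is strong, then N(Z) covers every X' ∈ 𝒳² with at most (K·N)² translates; that is, for every X' ∈ 𝒳² there is a finite set T ⊆ G with |T| ≤ (K·N)² such that X' ⊆ T·N(Z). -/

import Mathlib

open Pointwise

def IsApproxSubgroup {G : Type*} [Group G] (K : ℕ) (A : Set G) : Prop :=
  (1 : G) ∈ A ∧ A = A⁻¹ ∧ ∃ F : Finset G, F.card ≤ K ∧ A * A ⊆ (F : Set G) * A

def NComm {G : Type*} [Group G] (N : ℕ) (X Y : Set G) : Prop :=
  ∃ Z₀ Z₁ : Finset G, Z₀.card ≤ N ∧ Z₁.card ≤ N ∧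
    X ⊆ (Z₀ : Set G) * Y ∧ Y ⊆ (Z₁ : Set G) * X

noncomputable def idx {G : Type*} [Group G] (X Y : Set G) : ℕ :=
  sSup {n | ∃ X₀ : Finset G, (X₀ : Set G) ⊆ X ∧
    (X₀ : Set G).PairwiseDisjoint (fun x => x • Y) ∧ X₀.card = n}

/-- `𝒳² = {X·X : X ∈ 𝒳}`. -/
def sqFam {G : Type*} [Group G] (𝒳 : Set (Set G)) : Set (Set G) :=
  {A | ∃ X ∈ 𝒳, A = X * X}

/-- `𝒵`: unions of nonempty finite subfamilies of `𝒳²`. -/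
def unionFam {G : Type*} [Group G] (𝒳 : Set (Set G)) : Set (Set G) :=
  {Z | ∃ S : Finset (Set G), S.Nonempty ∧ (S : Set (Set G)) ⊆ sqFam 𝒳 ∧ Z = ⋃₀ (S : Set (Set G))}

/-- `n(Z)`: least size of a finite subfamily of `𝒳²` with union `Z`. -/
noncomputable def nOf {G : Type*} [Group G] (𝒳 : Set (Set G)) (Z : Set G) : ℕ :=
  sInf {n | ∃ S : Finset (Set G), S.Nonempty ∧ (S : Set (Set G)) ⊆ sqFam 𝒳 ∧
    Z = ⋃₀ (S : Set (Set G)) ∧ S.card = n}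

/-- `M(Z,k) = max{[X : (X∩Z)^(2^k)] : X ∈ 𝒳²}`. -/
noncomputable def Mval {G : Type*} [Group G] (𝒳 : Set (Set G)) (Z : Set G) (k : ℕ) : ℕ :=
  sSup {r | ∃ X ∈ sqFam 𝒳, r = idx X ((X ∩ Z) ^ (2 ^ k))}

/-- `m = min{M(Z,k) : Z ∈ 𝒵, k ∈ ℕ}`. -/
noncomputable def mnum {G : Type*} [Group G] (𝒳 : Set (Set G)) : ℕ :=
  sInf {r | ∃ Z ∈ unionFam 𝒳, ∃ k : ℕ, r = Mval 𝒳 Z k}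

/-- `𝒵_m = {Z ∈ 𝒵 : min_k M(Z,k) = m}`. -/
noncomputable def Zmfam {G : Type*} [Group G] (𝒳 : Set (Set G)) : Set (Set G) :=
  {Z | Z ∈ unionFam 𝒳 ∧ sInf {r | ∃ k : ℕ, r = Mval 𝒳 Z k} = mnum 𝒳}

/-- `k_Z`: the least `k` with `M(Z,k) = m`. -/
noncomputable def kOf {G : Type*} [Group G] (𝒳 : Set (Set G)) (Z : Set G) : ℕ :=
  sInf {k | Mval 𝒳 Z k = mnum 𝒳}

/-- `k₀ = min{k_Z : Z ∈ 𝒵_m}`. -/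
noncomputable def kzero {G : Type*} [Group G] (𝒳 : Set (Set G)) : ℕ :=
  sInf {k | ∃ Z ∈ Zmfam 𝒳, kOf 𝒳 Z = k}

/-- `Z` is strong: `Z ∈ 𝒵_m` and `k_Z = k₀`. -/
noncomputable def IsStrong {G : Type*} [Group G] (𝒳 : Set (Set G)) (Z : Set G) : Prop :=
  Z ∈ Zmfam 𝒳 ∧ kOf 𝒳 Z = kzero 𝒳

/-- `η(Z) = {X ∈ 𝒳² : [X : (X∩Z)^(2^(k₀+1))] = m}`. -/
noncomputable def etaFam {G : Type*} [Group G] (𝒳 : Set (Set G)) (Z : Set G) : Set (Set G) :=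
  {X | X ∈ sqFam 𝒳 ∧ idx X ((X ∩ Z) ^ (2 ^ (kzero 𝒳 + 1))) = mnum 𝒳}

/-- `N(Z) = ⋃_{X ∈ η(Z)} X ∩ (X∩Z)^(2^(k₀+1))`. -/
noncomputable def NSet {G : Type*} [Group G] (𝒳 : Set (Set G)) (Z : Set G) : Set G :=
  ⋃ X ∈ etaFam 𝒳 Z, X ∩ (X ∩ Z) ^ (2 ^ (kzero 𝒳 + 1))

/-- `n₀ = min{n(Z) : Z strong}`. -/
noncomputable def nzero {G : Type*} [Group G] (𝒳 : Set (Set G)) : ℕ :=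
  sInf {n | ∃ Z : Set G, IsStrong 𝒳 Z ∧ nOf 𝒳 Z = n}

/-- `N_Z = n₀^(2^(k₀+1)) · K^(2^(k₀+1)+4) · N^(2^(k₀+1))`. -/
noncomputable def NZconst {G : Type*} [Group G] (𝒳 : Set (Set G)) (K N : ℕ) : ℕ :=
  nzero 𝒳 ^ (2 ^ (kzero 𝒳 + 1)) * K ^ (2 ^ (kzero 𝒳 + 1) + 4) * N ^ (2 ^ (kzero 𝒳 + 1))

/-- `𝒤 = {N(Z) : Z strong containing a strong Z' with n(Z') = n₀}`. -/
noncomputable def famI {G : Type*} [Group G] (𝒳 : Set (Set G)) : Set (Set G) :=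
  {A | ∃ Z : Set G, IsStrong 𝒳 Z ∧
    (∃ Z' : Set G, IsStrong 𝒳 Z' ∧ Z' ⊆ Z ∧ nOf 𝒳 Z' = nzero 𝒳) ∧ A = NSet 𝒳 Z}

/-- `𝒤' = {N(Z) : Z strong with n(Z) = n₀}`. -/
noncomputable def famI' {G : Type*} [Group G] (𝒳 : Set (Set G)) : Set (Set G) :=
  {A | ∃ Z : Set G, IsStrong 𝒳 Z ∧ nOf 𝒳 Z = nzero 𝒳 ∧ A = NSet 𝒳 Z}

/-- `m' = min_{I ∈ 𝒤} max{[I:J] : J ∈ 𝒤'}`. -/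
noncomputable def mprime {G : Type*} [Group G] (𝒳 : Set (Set G)) : ℕ :=
  sInf {r | ∃ I ∈ famI 𝒳, r = sSup {s | ∃ J ∈ famI' 𝒳, s = idx I J}}

/-- `𝒤_{m'} = {I ∈ 𝒤 : max{[I:J] : J ∈ 𝒤'} = m'}`. -/
noncomputable def famImprime {G : Type*} [Group G] (𝒳 : Set (Set G)) : Set (Set G) :=
  {I | I ∈ famI 𝒳 ∧ sSup {s | ∃ J ∈ famI' 𝒳, s = idx I J} = mprime 𝒳}

/-- `𝒴`: finite unions of members of `𝒤_{m'}`. -/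
noncomputable def famY {G : Type*} [Group G] (𝒳 : Set (Set G)) : Set (Set G) :=
  {Y | ∃ S : Finset (Set G), S.Nonempty ∧ (S : Set (Set G)) ⊆ famImprime 𝒳 ∧
    Y = ⋃₀ (S : Set (Set G))}

/-- Two elements of `A ∩ z B` differ by an element of `A² ∩ B²`. -/
theorem aux_diff {G : Type*} [Group G] {A B : Set G} {k K : ℕ} (hA : IsApproxSubgroup K A)
    (hB : IsApproxSubgroup k B) {a a' z b b' : G} (ha : a ∈ A) (ha' : a' ∈ A) (hb : b ∈ B)
    (hb' : b' ∈ B) (e : z * b = a) (e' : z * b' = a') :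
    a⁻¹ * a' ∈ (A * A) ∩ (B * B) := by
  refine ⟨Set.mul_mem_mul ?_ ha', ?_⟩
  · rw [hA.2.1]; simpa using ha
  · have : a⁻¹ * a' = b⁻¹ * b' := by subst e e'; group
    rw [this]
    refine Set.mul_mem_mul ?_ hb'
    rw [hB.2.1]; simpa using hb

theorem aux_sub_pow {G : Type*} [Group G] {W : Set G} (h1 : (1 : G) ∈ W) (k : ℕ) :
    W ⊆ W ^ (2 ^ k) := by
  have := Set.pow_subset_pow_right h1 (Nat.one_le_two_pow (n := k))
  simpa using this

theorem aux_idx_mem {G : Type*} [Group G] {A B Y : Set G} {K N : ℕ} (hA : IsApproxSubgroup K A)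
    (hB : IsApproxSubgroup K B) (hAB : NComm N A B) (hY : (A * A) ∩ (B * B) ⊆ Y) :
    ∀ n ∈ {n | ∃ X₀ : Finset G, (X₀ : Set G) ⊆ A * A ∧
    (X₀ : Set G).PairwiseDisjoint (fun x => x • Y) ∧ X₀.card = n}, n ≤ K * N := by
  classical
  rintro n ⟨X₀, hX, hd, rfl⟩
  obtain ⟨F, hF, hFA⟩ := hA.2.2
  obtain ⟨Z₀, -, hZ, -, hZB, -⟩ := hAB
  have h1 : (1 : G) ∈ Y := hY ⟨⟨1, hA.1, 1, hA.1, by simp⟩, ⟨1, hB.1, 1, hB.1, by simp⟩⟩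
  have key : ∀ x ∈ X₀, ∃ p : G × G, p ∈ F ×ˢ Z₀ ∧ ∃ a ∈ A, ∃ b ∈ B, p.1 * a = x ∧
      p.2 * b = a := by
    intro x hx
    obtain ⟨f, hf, a, ha, e⟩ := hFA (hX hx)
    obtain ⟨z, hz, b, hb, e'⟩ := hZB ha
    exact ⟨(f, z), by simpa using ⟨hf, hz⟩, a, ha, b, hb, e, e'⟩
  choose! φ hφ hφ' using key
  calc X₀.card ≤ (F ×ˢ Z₀).card := by
        refine Finset.card_le_card_of_injOn φ hφ ?_
        intro x hx x' hx' hxx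
        obtain ⟨a, ha, b, hb, e, e1⟩ := hφ' x hx
        obtain ⟨a', ha', b', hb', e', e1'⟩ := hφ' x' hx'
        rw [← hxx] at e' e1'
        by_contra hne
        have hdis := hd hx hx' hne
        have hx'Y : x' ∈ x' • Y := ⟨1, h1, by simp⟩
        suffices hs : x' ∈ x • Y from Set.disjoint_left.1 hdis hs hx'Y
        refine ⟨x⁻¹ * x', hY ?_, by simp⟩
        have : x⁻¹ * x' = a⁻¹ * a' := by rw [← e, ← e']; group
        rw [this]
        exact aux_diff hA hB ha ha' hb hb' e1 e1'
    _ = F.card * Z₀.card := Finset.card_product _ _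
    _ ≤ K * N := Nat.mul_le_mul hF hZ

/-- Lemma 2.5: if `Z` is strong, then `N(Z)` covers every `X' ∈ 𝒳²`
with at most `(K·N)²` translates. -/
theorem NSet_covers
    {G : Type*} [Group G] (K N : ℕ) (𝒳 : Set (Set G)) (hne : 𝒳.Nonempty)
    (happrox : ∀ X ∈ 𝒳, IsApproxSubgroup K X)
    (hcomm : ∀ X ∈ 𝒳, ∀ Y ∈ 𝒳, NComm N X Y)
    (Z : Set G) (hZ : IsStrong 𝒳 Z) :
    ∀ X' ∈ sqFam 𝒳, ∃ T : Finset G, T.card ≤ (K * N) ^ 2 ∧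
      X' ⊆ (T : Set G) * NSet 𝒳 Z := by
  have hZu : Z ∈ unionFam 𝒳 := hZ.1.1
  obtain ⟨B, hB, hBZ⟩ : ∃ B ∈ 𝒳, B * B ⊆ Z := by
    obtain ⟨S, ⟨s, hs⟩, hS, rfl⟩ := hZu
    obtain ⟨B, hB, e⟩ := hS hs
    exact ⟨B, hB, e ▸ Set.subset_sUnion_of_mem (Finset.mem_coe.2 hs)⟩
  have hone : ∀ A ∈ 𝒳, (1 : G) ∈ (A * A) ∩ Z := fun A hA =>
    ⟨⟨1, (happrox A hA).1, 1, (happrox A hA).1, by simp⟩,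
      hBZ ⟨1, (happrox B hB).1, 1, (happrox B hB).1, by simp⟩⟩
  have hmem : ∀ A ∈ 𝒳, ∀ k : ℕ, ∀ n ∈ {n | ∃ X₀ : Finset G, (X₀ : Set G) ⊆ A * A ∧
      (X₀ : Set G).PairwiseDisjoint (fun x => x • ((A * A) ∩ Z) ^ (2 ^ k)) ∧ X₀.card = n},
      n ≤ K * N := fun A hA k => aux_idx_mem (happrox A hA) (happrox B hB) (hcomm A hA B hB)
        ((Set.inter_subset_inter_right _ hBZ).trans (aux_sub_pow (hone A hA) k))
  have hidx : ∀ A ∈ 𝒳, ∀ k : ℕ, idx (A * A) (((A * A) ∩ Z) ^ (2 ^ k)) ≤ K * N :=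
    fun A hA k => csSup_le ⟨0, ∅, by simp, by simp, by simp⟩ (hmem A hA k)
  have hbdd : ∀ k : ℕ, BddAbove {r | ∃ X ∈ sqFam 𝒳, r = idx X ((X ∩ Z) ^ (2 ^ k))} := by
    rintro k
    refine ⟨K * N, ?_⟩
    rintro r ⟨X, ⟨A, hA, rfl⟩, rfl⟩
    exact hidx A hA k
  have hnon : ∀ k : ℕ, {r | ∃ X ∈ sqFam 𝒳, r = idx X ((X ∩ Z) ^ (2 ^ k))}.Nonempty :=
    fun k => ⟨_, _, ⟨B, hB, rfl⟩, rfl⟩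
  have hk0 : Mval 𝒳 Z (kzero 𝒳) = mnum 𝒳 := by
    have h1 : mnum 𝒳 ∈ {r | ∃ k : ℕ, r = Mval 𝒳 Z k} := by
      rw [← hZ.1.2]; exact Nat.sInf_mem ⟨_, 0, rfl⟩
    obtain ⟨k, hk⟩ := h1
    rw [← hZ.2]
    exact Nat.sInf_mem (s := {k | Mval 𝒳 Z k = mnum 𝒳}) ⟨k, hk.symm⟩
  have hmono : Mval 𝒳 Z (kzero 𝒳 + 1) ≤ Mval 𝒳 Z (kzero 𝒳) := by
    refine csSup_le (hnon _) ?_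
    rintro r ⟨X, ⟨A, hA, rfl⟩, rfl⟩
    refine le_trans ?_ (le_csSup (hbdd _) ⟨_, ⟨A, hA, rfl⟩, rfl⟩)
    refine csSup_le_csSup ⟨K * N, hmem A hA _⟩ ⟨0, ∅, by simp, by simp, by simp⟩ ?_
    rintro n ⟨X₀, h1, h2, h3⟩
    refine ⟨X₀, h1, fun x hx y hy hxy => ?_, h3⟩
    have hsub : ((A * A) ∩ Z) ^ (2 ^ kzero 𝒳) ⊆ ((A * A) ∩ Z) ^ (2 ^ (kzero 𝒳 + 1)) :=
      Set.pow_subset_pow_right (hone A hA) (Nat.pow_le_pow_right (by norm_num) (by omega))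
    exact (h2 hx hy hxy).mono (Set.smul_set_mono hsub) (Set.smul_set_mono hsub)
  have hk1 : Mval 𝒳 Z (kzero 𝒳 + 1) = mnum 𝒳 :=
    le_antisymm (hmono.trans hk0.le) (Nat.sInf_le ⟨Z, hZu, _, rfl⟩)
  obtain ⟨X, ⟨A, hA, rfl⟩, hX⟩ := Nat.sSup_mem (hnon (kzero 𝒳 + 1)) (hbdd _)
  have heta : A * A ∈ etaFam 𝒳 Z := ⟨⟨A, hA, rfl⟩, hX.symm.trans hk1⟩
  have hsub : (A * A) ∩ (B * B) ⊆ NSet 𝒳 Z := fun g hg =>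
    Set.mem_biUnion heta ⟨hg.1, aux_sub_pow (hone A hA) _ ⟨hg.1, hBZ hg.2⟩⟩
  rintro X' ⟨A', hA', rfl⟩
  classical
  obtain ⟨F, hF, hFA⟩ := (happrox A' hA').2.2
  obtain ⟨Z₁, -, hZ₁, -, hc₁, -⟩ := hcomm A' hA' A hA
  obtain ⟨Z₂, -, hZ₂, -, hc₂, -⟩ := hcomm A hA B hB
  -- representatives of the pieces `z B ∩ A`
  have hrep : ∀ z : G, ∃ c : G, ∀ a ∈ A, ∀ b ∈ B, z * b = a → c⁻¹ * a ∈ (A * A) ∩ (B * B) := by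
    intro z
    by_cases h : ∃ c ∈ A, ∃ b ∈ B, z * b = c
    · obtain ⟨c, hc, b, hb, e⟩ := h
      exact ⟨c, fun a ha b' hb' e' =>
        aux_diff (happrox A hA) (happrox B hB) hc ha hb hb' e e'⟩
    · exact ⟨1, fun a ha b hb e => (h ⟨a, ha, b, hb, e⟩).elim⟩
  choose c hcA using hrep
  refine ⟨F * Z₁ * Z₂.image c, ?_, ?_⟩
  · have hK : 1 ≤ K := by
      refine le_trans (Finset.card_pos.2 ?_) hF
      obtain ⟨f, hf, -⟩ := hFA ⟨1, (happrox A' hA').1, 1, (happrox A' hA').1, rfl⟩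
      exact ⟨f, hf⟩
    calc (F * Z₁ * Z₂.image c).card ≤ (F * Z₁).card * (Z₂.image c).card := Finset.card_mul_le
      _ ≤ (F.card * Z₁.card) * Z₂.card :=
        Nat.mul_le_mul Finset.card_mul_le Finset.card_image_le
      _ ≤ (K * N) * N := Nat.mul_le_mul (Nat.mul_le_mul hF hZ₁) hZ₂
      _ ≤ (K * N) * (K * N) := Nat.mul_le_mul le_rfl (Nat.le_mul_of_pos_left N hK)
      _ = (K * N) ^ 2 := by ring
  · intro x hx
    obtain ⟨f, hf, a', ha', e⟩ := hFA hx
    obtain ⟨z, hz, a, ha, e'⟩ := hc₁ ha'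
    obtain ⟨w, hw, b, hb, e''⟩ := hc₂ ha
    refine ⟨f * z * c w, ?_, (c w)⁻¹ * a, hsub (hcA w a ha b hb e''), ?_⟩
    · exact Finset.mem_coe.2 (Finset.mul_mem_mul (Finset.mul_mem_mul hf hz)
        (Finset.mem_image_of_mem c hw))
    · simp only at e e' ⊢
      rw [← e, ← e']; group
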